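/- Let K_1, …, K_m be convex bodies (nonempty compact convex sets) in ℝ^n. Then there exists a homogeneous polynomial P of degree n in m variables with real coefficients such that for all nonnegative reals λ_1, …, λ_m, the Lebesgue volume of the Minkowski linear combination λ_1 K_1 + λ_2 K_2 + ⋯ + λ_m K_m equals P(λ_1, …, λ_m). (The coefficient of λ_1⋯λ_n in P, divided by n!, is by definition the mixed volume of the bodies when m = n.) -/

import Mathlib

open Pointwise MeasureTheory

lemma poly_integral {X : Type*} [MeasurableSpace X] (μ : Measure X) (n m : ℕ)
    (q : X → MvPolynomial (Fin m) ℝ) (hq : ∀ x, (q x).IsHomogeneous n)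
    (hIntg : ∀ lam : Fin m → ℝ, (∀ i, 0 ≤ lam i) →
      Integrable (fun x => MvPolynomial.eval lam (q x)) μ) :
    ∃ P : MvPolynomial (Fin m) ℝ, P.IsHomogeneous n ∧
      ∀ lam : Fin m → ℝ, (∀ i, 0 ≤ lam i) →
        ∫ x, MvPolynomial.eval lam (q x) ∂μ = MvPolynomial.eval lam P := by
  let W := MvPolynomial.homogeneousSubmodule (Fin m) ℝ n
  have : FiniteDimensional ℝ W :=
    Module.Finite.iff_fg.mpr (MvPolynomial.homogeneousSubmodule_fg (R := ℝ) (σ := Fin m) n)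
  let L : {lam : Fin m → ℝ // ∀ i, 0 ≤ lam i} → (W →ₗ[ℝ] ℝ) := fun lam =>
    (MvPolynomial.aeval lam.1 : MvPolynomial (Fin m) ℝ →ₐ[ℝ] ℝ).toLinearMap ∘ₗ W.subtype
  have hL : ∀ lam (w : W), L lam w = MvPolynomial.eval lam.1 (w : MvPolynomial (Fin m) ℝ) := by
    intro lam w
    simp [L]
  let Q : X → W := fun x => ⟨q x, hq x⟩
  have hker : ⨅ i, (L i).ker = ⊥ := by
    rw [eq_bot_iff]
    intro w hw
    rw [Submodule.mem_iInf] at hw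
    rw [Submodule.mem_bot]
    apply Subtype.ext
    apply MvPolynomial.funext_set (fun _ => Set.Ici (0:ℝ)) (fun _ => Set.Ici_infinite 0)
    intro x hx
    have := hw ⟨x, fun i => hx i (Set.mem_univ i)⟩
    rw [LinearMap.mem_ker, hL] at this
    simpa using this
  have key : ∀ c : W →ₗ[ℝ] ℝ, Integrable (fun x => c (Q x)) μ := by
    intro c
    have hc : c ∈ Submodule.span ℝ (Set.range L) := by
      apply FiniteDimensional.mem_span_of_iInf_ker_le_ker
      rw [hker]; exact bot_le
    induction hc using Submodule.span_induction with
    | mem c hc =>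
      obtain ⟨lam, rfl⟩ := hc
      simp only [hL]
      exact hIntg lam.1 lam.2
    | zero => simp
    | add a b _ _ ha hb => exact ha.add hb
    | smul r a _ ha => exact ha.const_mul r
  let b := Module.finBasis ℝ W
  refine ⟨((∑ k, (∫ x, b.coord k (Q x) ∂μ) • b k : W) : MvPolynomial (Fin m) ℝ),
    (∑ k, (∫ x, b.coord k (Q x) ∂μ) • b k : W).2, ?_⟩
  intro lam hlam
  have h1 : ∀ w : W, MvPolynomial.eval lam (w : MvPolynomial (Fin m) ℝ) = L ⟨lam, hlam⟩ w :=
    fun w => (hL ⟨lam, hlam⟩ w).symm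
  rw [h1]
  have h2 : ∀ x, MvPolynomial.eval lam (q x) = ∑ k, b.coord k (Q x) * L ⟨lam, hlam⟩ (b k) := by
    intro x
    change MvPolynomial.eval lam (Q x : MvPolynomial (Fin m) ℝ) = _
    rw [h1]
    conv_lhs => rw [← b.sum_repr (Q x)]
    rw [map_sum]
    simp only [map_smul, smul_eq_mul, Module.Basis.coord_apply]
  simp only [h2]
  rw [integral_finsetSum _ (fun k _ => (key _).mul_const _)]
  simp [integral_mul_const]

lemma det_poly {n m : ℕ} (M : Fin m → Matrix (Fin n) (Fin n) ℝ) :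
    ∃ q : MvPolynomial (Fin m) ℝ, q.IsHomogeneous n ∧
      ∀ lam : Fin m → ℝ, MvPolynomial.eval lam q = (∑ i, lam i • M i).det := by
  refine ⟨(∑ i, (MvPolynomial.X i : MvPolynomial (Fin m) ℝ) •
    (M i).map (MvPolynomial.C : ℝ →+* MvPolynomial (Fin m) ℝ)).det, ?_, ?_⟩
  · rw [Matrix.det_apply]
    apply MvPolynomial.IsHomogeneous.sum
    intro σ _
    have h : (∏ i, (∑ i, (MvPolynomial.X i : MvPolynomial (Fin m) ℝ) •
      (M i).map (MvPolynomial.C : ℝ →+* MvPolynomial (Fin m) ℝ)) (σ i) i).IsHomogeneous n := by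
      have := MvPolynomial.IsHomogeneous.prod (Finset.univ : Finset (Fin n))
        (fun i => (∑ i, (MvPolynomial.X i : MvPolynomial (Fin m) ℝ) •
      (M i).map (MvPolynomial.C : ℝ →+* MvPolynomial (Fin m) ℝ)) (σ i) i) (fun _ => 1) ?_
      · simpa using this
      · intro j _
        simp only [Matrix.sum_apply, Matrix.smul_apply, Matrix.map_apply, smul_eq_mul]
        apply MvPolynomial.IsHomogeneous.sum
        intro i _
        simpa using (MvPolynomial.isHomogeneous_X ℝ i).mul
          (MvPolynomial.isHomogeneous_C (Fin m) (M i (σ j) j))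
    rcases Int.units_eq_one_or (Equiv.Perm.sign σ) with h' | h' <;> rw [h']
    · simpa using h
    · simpa using h.neg
  · intro lam
    rw [RingHom.map_det]
    congr 1
    ext j k
    simp [Matrix.sum_apply]

/-- tangent inequality -/
lemma tangent_le {E : Type*} [NormedAddCommGroup E] [NormedSpace ℝ E] {φ : E → ℝ}
    (hc : ConvexOn ℝ Set.univ φ) (hd : Differentiable ℝ φ) (x z : E) :
    φ x + fderiv ℝ φ x (z - x) ≤ φ z := by
  let l : ℝ →ᵃ[ℝ] E := AffineMap.lineMap x z
  have h1 : ConvexOn ℝ Set.univ (φ ∘ l) := by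
    simpa using hc.comp_affineMap l
  have h2 : HasDerivAt (φ ∘ l) (fderiv ℝ φ x (z - x)) 0 := by
    have ha : HasFDerivAt φ (fderiv ℝ φ x) (l 0) := by
      simpa [l] using (hd x).hasFDerivAt
    have hb : HasDerivAt l (z - x) 0 := by
      simpa [l] using (AffineMap.hasDerivAt_lineMap (a := x) (b := z) (x := (0:ℝ)))
    exact ha.comp_hasDerivAt 0 hb
  have := h1.le_slope_of_hasDerivAt (Set.mem_univ 0) (Set.mem_univ 1) one_pos h2
  simp only [slope_def_field, l, Function.comp, AffineMap.lineMap_apply_zero,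
    AffineMap.lineMap_apply_one, sub_zero, div_one] at this
  linarith

section
variable {n : ℕ}

local notation "𝔼" => EuclideanSpace ℝ (Fin n)

/-- Hessian matrix -/
noncomputable def hess {n : ℕ} (φ : EuclideanSpace ℝ (Fin n) → ℝ) (x : EuclideanSpace ℝ (Fin n)) :
    Matrix (Fin n) (Fin n) ℝ :=
  Matrix.of fun j k => fderiv ℝ (fderiv ℝ φ) x (EuclideanSpace.basisFun (Fin n) ℝ k)
    (EuclideanSpace.basisFun (Fin n) ℝ j)

/-- gradient -/
noncomputable def grd {n : ℕ} (φ : EuclideanSpace ℝ (Fin n) → ℝ) (x : EuclideanSpace ℝ (Fin n)) :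
    EuclideanSpace ℝ (Fin n) :=
  (InnerProductSpace.toDual ℝ (EuclideanSpace ℝ (Fin n))).symm (fderiv ℝ φ x)

/-- Riesz map as a continuous linear map -/
noncomputable def riesz (n : ℕ) :
    (EuclideanSpace ℝ (Fin n) →L[ℝ] ℝ) →L[ℝ] EuclideanSpace ℝ (Fin n) :=
  LinearMap.toContinuousLinearMap
    { toFun := fun l => (InnerProductSpace.toDual ℝ (EuclideanSpace ℝ (Fin n))).symm l
      map_add' := fun a b => map_add _ a b
      map_smul' := fun r a => by simp }

/-- derivative of the gradient -/
noncomputable def dgrd {n : ℕ} (φ : EuclideanSpace ℝ (Fin n) → ℝ) (x : EuclideanSpace ℝ (Fin n)) :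
    EuclideanSpace ℝ (Fin n) →L[ℝ] EuclideanSpace ℝ (Fin n) :=
  riesz n ∘L fderiv ℝ (fderiv ℝ φ) x

lemma inner_grd (φ : 𝔼 → ℝ) (x v : 𝔼) : inner ℝ (grd φ x) v = fderiv ℝ φ x v := by
  simp [grd]

lemma inner_dgrd (φ : 𝔼 → ℝ) (x w v : 𝔼) :
    inner ℝ (dgrd φ x w) v = fderiv ℝ (fderiv ℝ φ) x w v := by
  simp [dgrd, riesz]

lemma diff1 {φ : 𝔼 → ℝ} (h : ContDiff ℝ 2 φ) : Differentiable ℝ φ :=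
  h.differentiable (by norm_num)

lemma cd_fderiv {φ : 𝔼 → ℝ} (h : ContDiff ℝ 2 φ) : ContDiff ℝ 1 (fderiv ℝ φ) :=
  h.fderiv_right (by norm_num)

lemma hasFDerivAt_grd {φ : 𝔼 → ℝ} (h : ContDiff ℝ 2 φ) (x : 𝔼) :
    HasFDerivAt (grd φ) (dgrd φ x) x := by
  have h2 : HasFDerivAt (fderiv ℝ φ) (fderiv ℝ (fderiv ℝ φ) x) x :=
    ((cd_fderiv h).differentiable (by norm_num) x).hasFDerivAt
  exact (riesz n).hasFDerivAt.comp x h2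

lemma continuous_dgrd {φ : 𝔼 → ℝ} (h : ContDiff ℝ 2 φ) : Continuous (dgrd φ) := by
  have h2 : Continuous (fderiv ℝ (fderiv ℝ φ)) := (cd_fderiv h).continuous_fderiv (by norm_num)
  exact (continuous_const (y := riesz n)).clm_comp h2

lemma det_dgrd (φ : 𝔼 → ℝ) (x : 𝔼) : (dgrd φ x).det = (hess φ x).det := by
  rw [ContinuousLinearMap.det, ← LinearMap.det_toMatrix (EuclideanSpace.basisFun (Fin n) ℝ).toBasis]
  congr 1
  ext j k
  rw [LinearMap.toMatrix_apply]
  simp only [hess, Matrix.of_apply, ← inner_dgrd, OrthonormalBasis.coe_toBasis,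
    OrthonormalBasis.coe_toBasis_repr_apply, ContinuousLinearMap.coe_coe]
  rw [OrthonormalBasis.repr_apply_apply, real_inner_comm]

lemma grd_mono {φ : 𝔼 → ℝ} (h : ContDiff ℝ 2 φ) (hc : ConvexOn ℝ Set.univ φ) (x y : 𝔼) :
    0 ≤ inner ℝ (grd φ y - grd φ x) (y - x) := by
  have h1 := tangent_le hc (diff1 h) x y
  have h2 := tangent_le hc (diff1 h) y x
  rw [← inner_grd] at h1 h2
  rw [← neg_sub y x, inner_neg_right] at h2
  rw [inner_sub_left]
  linarith

lemma line_deriv {φ : 𝔼 → ℝ} (h : ContDiff ℝ 2 φ) (x v : 𝔼) :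
    HasDerivAt (fun t : ℝ => grd φ (x + t • v)) (dgrd φ x v) 0 := by
  have ha : HasFDerivAt (grd φ) (dgrd φ x) (x + (0:ℝ) • v) := by
    simpa using hasFDerivAt_grd h x
  have hb : HasDerivAt (fun t : ℝ => x + t • v) v 0 := by
    simpa using ((hasDerivAt_id (0:ℝ)).smul_const v).const_add x
  exact ha.comp_hasDerivAt 0 hb

lemma hess_psd {φ : 𝔼 → ℝ} (h : ContDiff ℝ 2 φ) (hc : ConvexOn ℝ Set.univ φ) (x v : 𝔼) :
    0 ≤ fderiv ℝ (fderiv ℝ φ) x v v := by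
  have h1 : HasDerivAt (fun t : ℝ => inner ℝ (grd φ (x + t • v)) v)
      (fderiv ℝ (fderiv ℝ φ) x v v) 0 := by
    rw [← inner_dgrd]
    simpa using (line_deriv h x v).inner ℝ (hasDerivAt_const (0:ℝ) v)
  rw [← h1.deriv]
  apply Monotone.deriv_nonneg
  intro s t hst
  have := grd_mono h hc (x + s • v) (x + t • v)
  rw [show x + t • v - (x + s • v) = (t - s) • v by module, inner_smul_right, inner_sub_left] at this
  rcases hst.eq_or_lt with rfl | hlt
  · exact le_rfl
  · have := nonneg_of_mul_nonneg_right this (by linarith)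
    simp only
    linarith

lemma hess_det_nonneg {φ : 𝔼 → ℝ} (h : ContDiff ℝ 2 φ) (hc : ConvexOn ℝ Set.univ φ) (x : 𝔼) :
    0 ≤ (hess φ x).det := by
  apply Matrix.PosSemidef.det_nonneg
  have hs : IsSymmSndFDerivAt ℝ φ x := h.contDiffAt.isSymmSndFDerivAt (by simp)
  refine Matrix.PosSemidef.of_dotProduct_mulVec_nonneg ?_ ?_
  · ext j k
    simp only [hess, Matrix.conjTranspose_apply, Matrix.of_apply, star_trivial]
    exact hs.eq _ _
  · intro v
    have := hess_psd h hc x (∑ k, v k • EuclideanSpace.basisFun (Fin n) ℝ k)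
    refine this.trans_eq (Eq.symm ?_)
    simp only [dotProduct, Matrix.mulVec, hess, Matrix.of_apply, map_sum, map_smul,
      sum_apply, smul_apply, smul_eq_mul, Pi.star_apply,
      star_trivial]
    refine Finset.sum_congr rfl fun j _ => ?_
    congr 1
    refine Finset.sum_congr rfl fun k _ => ?_
    ring

lemma grd_injOn {φ : 𝔼 → ℝ} (h : ContDiff ℝ 2 φ) (hc : ConvexOn ℝ Set.univ φ) :
    Set.InjOn (grd φ) {x | (dgrd φ x).det ≠ 0} := by
  intro x hx y _ hxy
  set p := grd φ x with hp
  -- every point of the segment has gradient `p`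
  have hT := fun a b => tangent_le hc (diff1 h) a b
  simp only [← inner_grd] at hT
  have hseg : ∀ t ∈ Set.Icc (0:ℝ) 1, grd φ (x + t • (y - x)) = p := by
    intro t ht
    set z := x + t • (y - x) with hz
    have hφz : φ z ≤ φ x + t * inner ℝ p (y - x) := by
      have h1 := hc.2 (Set.mem_univ x) (Set.mem_univ y) (sub_nonneg.2 ht.2) ht.1 (by ring)
      rw [show (1 - t) • x + t • y = z by rw [hz]; module] at h1
      have h2 := hT y x
      rw [← hxy, ← neg_sub y x, inner_neg_right] at h2
      simp only [smul_eq_mul] at h1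
      nlinarith [ht.1]
    -- minimum
    have hmin : ∀ w, φ z + inner ℝ p (w - z) ≤ φ w := by
      intro w
      have h1 := hT x w
      rw [← hp] at h1
      have : inner ℝ p (w - z) = inner ℝ p (w - x) - t * inner ℝ p (y - x) := by
        rw [show w - z = (w - x) - t • (y - x) by rw [hz]; module, inner_sub_right,
          inner_smul_right]
      linarith
    have hlm : IsLocalMin (fun w => φ w - inner ℝ p w) z := by
      refine Filter.Eventually.of_forall fun w => ?_
      have := hmin w
      rw [inner_sub_right] at this
      simp only
      linarith
    have h0 := hlm.fderiv_eq_zero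
    have h3 : HasFDerivAt (fun w => φ w - inner ℝ p w) (fderiv ℝ φ z - innerSL ℝ p) z :=
      (diff1 h z).hasFDerivAt.sub (innerSL ℝ p).hasFDerivAt
    rw [h3.fderiv, sub_eq_zero] at h0
    apply ext_inner_right ℝ
    intro v
    rw [inner_grd, h0]
    simp
  have hd0 : dgrd φ x (y - x) = 0 := by
    have h1 := (line_deriv h x (y - x)).hasDerivWithinAt (s := Set.Icc 0 1)
    have h2 : HasDerivWithinAt (fun t : ℝ => grd φ (x + t • (y - x))) 0 (Set.Icc 0 1) 0 :=
      (hasDerivWithinAt_const (0:ℝ) (Set.Icc 0 1) p).congr hseg (hseg 0 (by simp))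
    exact ((uniqueDiffOn_Icc_zero_one 0 (by simp)).eq_deriv _ h1 h2)
  have : y - x = 0 := by
    by_contra hne
    apply hx
    have : LinearMap.ker (dgrd φ x : 𝔼 →ₗ[ℝ] 𝔼) ≠ ⊥ := by
      intro hk
      apply hne
      rw [← Submodule.mem_bot ℝ, ← hk]
      exact hd0
    by_contra hdet
    exact this (LinearMap.ker_eq_bot.2 ((LinearMap.equivOfDetNeZero _ hdet).injective))
  exact (sub_eq_zero.1 this).symm

lemma volume_range {φ : 𝔼 → ℝ} (h : ContDiff ℝ 2 φ) (hc : ConvexOn ℝ Set.univ φ) :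
    volume (Set.range (grd φ)) = ∫⁻ x, ENNReal.ofReal (hess φ x).det := by
  set S : Set 𝔼 := {x | (dgrd φ x).det ≠ 0} with hS
  have hcont : Continuous fun x => (dgrd φ x).det :=
    ContinuousLinearMap.continuous_det.comp (continuous_dgrd h)
  have hSm : MeasurableSet S := (isOpen_ne_fun hcont continuous_const).measurableSet
  have h1 := lintegral_abs_det_fderiv_eq_addHaar_image volume hSm
    (fun x _ => (hasFDerivAt_grd h x).hasFDerivWithinAt) (grd_injOn h hc)
  have h2 := addHaar_image_eq_zero_of_det_fderivWithin_eq_zero (f := grd φ) (s := Sᶜ) volume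
    (fun x _ => (hasFDerivAt_grd h x).hasFDerivWithinAt) (by intro x hx; simpa [hS] using hx)
  have h3 : volume (Set.range (grd φ)) = volume (grd φ '' S) := by
    rw [← Set.image_univ, ← Set.union_compl_self S, Set.image_union]
    exact le_antisymm ((measure_union_le _ _).trans (by rw [h2, add_zero]))
      (measure_mono Set.subset_union_left)
  rw [h3, ← h1, ← lintegral_indicator hSm]
  congr 1
  ext x
  by_cases hx : x ∈ S
  · rw [Set.indicator_of_mem hx, det_dgrd, abs_of_nonneg (hess_det_nonneg h hc x)]
  · rw [Set.indicator_of_notMem hx, ← det_dgrd]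
    have : (dgrd φ x).det = 0 := by simpa [hS] using hx
    rw [this]; simp

end

section
variable {n : ℕ}

local notation "𝔼" => EuclideanSpace ℝ (Fin n)

/-- `h` is the support function of `K` -/
def IsSupp {n : ℕ} (K : Set (EuclideanSpace ℝ (Fin n))) (h : EuclideanSpace ℝ (Fin n) → ℝ) : Prop :=
  (∀ x, ∀ y ∈ K, inner ℝ y x ≤ h x) ∧ ∀ x, ∃ y ∈ K, h x = inner ℝ y x

/-- `φ` is a smooth convex function close to the support function `h`. -/
structure IsApx {n : ℕ} (h φ : EuclideanSpace ℝ (Fin n) → ℝ) : Prop where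
  cd : ContDiff ℝ 2 φ
  cv : ConvexOn ℝ Set.univ φ
  up : ∀ x v, φ (x + v) ≤ φ x + h v
  lo : ∃ C, ∀ x, h x ≤ φ x + C

lemma exists_supp {K : Set 𝔼} (hne : K.Nonempty) (hK : IsCompact K) : ∃ h, IsSupp K h := by
  have : ∀ x : 𝔼, ∃ y ∈ K, IsMaxOn (fun y => inner ℝ y x) K y := fun x =>
    hK.exists_isMaxOn hne (by fun_prop)
  choose y hy hm using this
  exact ⟨fun x => inner ℝ (y x) x, fun x z hz => hm x hz, fun x => ⟨y x, hy x, rfl⟩⟩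

lemma IsSupp.sub {K : Set 𝔼} {h : 𝔼 → ℝ} (hh : IsSupp K h) (x y : 𝔼) : h (x + y) ≤ h x + h y := by
  obtain ⟨z, hz, e⟩ := hh.2 (x + y)
  rw [e, inner_add_right]
  exact add_le_add (hh.1 _ _ hz) (hh.1 _ _ hz)

lemma IsSupp.convex {K : Set 𝔼} {h : 𝔼 → ℝ} (hh : IsSupp K h) : ConvexOn ℝ Set.univ h := by
  refine ⟨convex_univ, fun x _ y _ a b ha hb _ => ?_⟩
  obtain ⟨z, hz, e⟩ := hh.2 (a • x + b • y)
  rw [e, inner_add_right, inner_smul_right, inner_smul_right]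
  exact add_le_add (mul_le_mul_of_nonneg_left (hh.1 _ _ hz) ha)
    (mul_le_mul_of_nonneg_left (hh.1 _ _ hz) hb)

lemma IsSupp.bound {K : Set 𝔼} {h : 𝔼 → ℝ} (hh : IsSupp K h) (hK : IsCompact K) :
    ∃ R, 0 ≤ R ∧ ∀ x, h x ≤ R * ‖x‖ := by
  obtain ⟨R, hR0, hR⟩ := hK.isBounded.exists_pos_norm_le
  refine ⟨R, hR0.le, fun x => ?_⟩
  obtain ⟨z, hz, e⟩ := hh.2 x
  rw [e]
  exact (real_inner_le_norm _ _).trans (mul_le_mul_of_nonneg_right (hR z hz) (norm_nonneg _))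

lemma IsSupp.continuous {K : Set 𝔼} {h : 𝔼 → ℝ} (hh : IsSupp K h) : Continuous h := by
  have := hh.convex.continuousOn isOpen_univ
  rwa [continuousOn_univ] at this

lemma exists_apx {K : Set 𝔼} {h : 𝔼 → ℝ} (hh : IsSupp K h) (hK : IsCompact K) :
    ∃ φ, IsApx h φ := by
  let f : ContDiffBump (0 : 𝔼) := ⟨1, 2, one_pos, one_lt_two⟩
  let ρ := f.normed volume
  have hρc : Continuous ρ := f.contDiff_normed.continuous (n := 0)
  have hρs : HasCompactSupport ρ := f.hasCompactSupport_normed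
  have hρ0 : ∀ x, 0 ≤ ρ x := f.nonneg_normed
  have hρ1 : ∫ x, ρ x = 1 := f.integral_normed
  let φ := convolution ρ h (ContinuousLinearMap.lsmul ℝ ℝ) volume
  have hφ : ∀ x, φ x = ∫ t, ρ t * h (x - t) := fun x => by
    simp [φ, convolution_def]
  have hhc := hh.continuous
  have hIntg : ∀ g : 𝔼 → ℝ, Continuous g → Integrable (fun t => ρ t * g t) := fun g hg =>
    (hρc.mul hg).integrable_of_hasCompactSupport hρs.mul_right
  have hi : ∀ x, Integrable (fun t => ρ t * h (x - t)) := fun x =>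
    hIntg (fun t => h (x - t)) (by fun_prop)
  have hconst : ∀ c : ℝ, ∫ t, ρ t * c = c := fun c => by
    rw [integral_mul_const, hρ1, one_mul]
  refine ⟨φ, ?_, ?_, ?_, ?_⟩
  · exact hρs.contDiff_convolution_left (n := 2) _ f.contDiff_normed hhc.locallyIntegrable
  · refine ⟨convex_univ, fun x _ y _ a b ha hb hab => ?_⟩
    simp only [hφ, smul_eq_mul]
    rw [← integral_const_mul, ← integral_const_mul,
      ← integral_add ((hi x).const_mul a) ((hi y).const_mul b)]
    refine integral_mono (hi _) (((hi x).const_mul a).add ((hi y).const_mul b)) fun t => ?_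
    have := hh.convex.2 (Set.mem_univ (x - t)) (Set.mem_univ (y - t)) ha hb hab
    rw [show a • (x - t) + b • (y - t) = a • x + b • y - (a + b) • t by module, hab, one_smul] at this
    simp only [smul_eq_mul] at this
    have := mul_le_mul_of_nonneg_left this (hρ0 t)
    simp only
    linarith
  · intro x v
    rw [hφ, hφ, ← hconst (h v), ← integral_add (hi x) (hIntg (fun _ => h v) continuous_const)]
    refine integral_mono (hi _) ((hi x).add (hIntg (fun _ => h v) continuous_const)) fun t => ?_
    have := hh.sub (x - t) v
    rw [show x - t + v = x + v - t by abel] at this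
    have := mul_le_mul_of_nonneg_left this (hρ0 t)
    simp only
    linarith
  · obtain ⟨R, hR0, hR⟩ := hh.bound hK
    refine ⟨R * 2, fun x => ?_⟩
    rw [hφ, ← hconst (R * 2), ← integral_add (hi x) (hIntg (fun _ => R * 2) continuous_const)]
    rw [← hconst (h x)]
    refine integral_mono (hIntg (fun _ => h x) continuous_const)
      ((hi x).add (hIntg (fun _ => R * 2) continuous_const)) fun t => ?_
    by_cases ht : ρ t = 0
    · simp [ht]
    · have ht' : t ∈ Function.support ρ := ht
      rw [f.support_normed_eq] at ht'
      have ht2 : ‖t‖ ≤ 2 := by simpa [f] using (Metric.mem_ball.1 ht').le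
      have h1 := hh.sub (x - t) t
      rw [sub_add_cancel] at h1
      have h2 := (hR t).trans (mul_le_mul_of_nonneg_left ht2 hR0)
      have := mul_le_mul_of_nonneg_left (h1.trans (add_le_add le_rfl h2)) (hρ0 t)
      simp only
      linarith

lemma grd_mem {K : Set 𝔼} {h φ : 𝔼 → ℝ} (hh : IsSupp K h) (hK : IsCompact K) (hc : Convex ℝ K)
    (ha : IsApx h φ) (x : 𝔼) : grd φ x ∈ K := by
  by_contra hx
  obtain ⟨f, u, hf, hu⟩ := geometric_hahn_banach_closed_point hc hK.isClosed hx
  set v := (InnerProductSpace.toDual ℝ 𝔼).symm f with hv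
  have hfv : ∀ y, f y = inner ℝ y v := fun y => by
    rw [real_inner_comm, hv, InnerProductSpace.toDual_symm_apply]
  have h1 := tangent_le ha.cv (diff1 ha.cd) x (x + v)
  have h2 := ha.up x v
  rw [← inner_grd, add_sub_cancel_left, ← hfv] at h1
  obtain ⟨z, hz, e⟩ := hh.2 v
  have h3 := hf z hz
  rw [hfv, ← e] at h3
  linarith

lemma interior_subset_range {K : Set 𝔼} {h φ : 𝔼 → ℝ} (hh : IsSupp K h)
    (ha : IsApx h φ) : interior K ⊆ Set.range (grd φ) := by
  intro p hp
  obtain ⟨r, hr, hball⟩ := Metric.mem_nhds_iff.1 (mem_interior_iff_mem_nhds.1 hp)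
  obtain ⟨C, hC⟩ := ha.lo
  have hlow : ∀ x, r / 2 * ‖x‖ - C ≤ φ x - inner ℝ p x := by
    intro x
    have h1 : inner ℝ p x + r / 2 * ‖x‖ ≤ h x := by
      by_cases hx : x = 0
      · subst hx
        have := hh.1 0 p (interior_subset hp)
        simpa using this
      · have hx' : ‖x‖ ≠ 0 := norm_ne_zero_iff.2 hx
        have := hh.1 x (p + (r / 2 / ‖x‖) • x) (hball (by
          rw [Metric.mem_ball, dist_eq_norm, add_sub_cancel_left, norm_smul, Real.norm_eq_abs,
            abs_of_nonneg (by positivity), div_mul_cancel₀ _ hx']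
          linarith))
        rw [inner_add_left, inner_smul_left, real_inner_self_eq_norm_sq] at this
        convert this using 2
        simp
        field_simp
    linarith [hC x]
  have hcont : Continuous fun x => φ x - inner ℝ p x :=
    (diff1 ha.cd).continuous.sub (by fun_prop)
  have hten : Filter.Tendsto (fun x => φ x - inner ℝ p x) (Filter.cocompact 𝔼) Filter.atTop := by
    refine Filter.tendsto_atTop_mono hlow ?_
    exact Filter.tendsto_atTop_add_const_right _ (-C)
      (tendsto_norm_cocompact_atTop.const_mul_atTop (by positivity))
  obtain ⟨z, hz⟩ := hcont.exists_forall_le hten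
  refine ⟨z, ?_⟩
  have hlm : IsLocalMin (fun w => φ w - inner ℝ p w) z := Filter.Eventually.of_forall hz
  have h0 := hlm.fderiv_eq_zero
  have h3 : HasFDerivAt (fun w => φ w - inner ℝ p w) (fderiv ℝ φ z - innerSL ℝ p) z :=
    (diff1 ha.cd z).hasFDerivAt.sub (innerSL ℝ p).hasFDerivAt
  rw [h3.fderiv, sub_eq_zero] at h0
  apply ext_inner_right ℝ
  intro v
  rw [inner_grd, h0]
  simp

lemma volume_eq {K : Set 𝔼} {h φ : 𝔼 → ℝ} (hh : IsSupp K h) (hK : IsCompact K) (hc : Convex ℝ K)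
    (ha : IsApx h φ) : Integrable (fun x => (hess φ x).det) ∧
      (volume K).toReal = ∫ x, (hess φ x).det := by
  have h1 : volume K = ∫⁻ x, ENNReal.ofReal (hess φ x).det := by
    rw [← volume_range ha.cd ha.cv]
    apply le_antisymm
    · calc volume K ≤ volume (interior K ∪ frontier K) := by
            apply measure_mono
            rw [← closure_eq_interior_union_frontier]
            exact subset_closure
        _ ≤ volume (interior K) + volume (frontier K) := measure_union_le _ _
        _ = volume (interior K) := by rw [hc.addHaar_frontier volume, add_zero]
        _ ≤ _ := measure_mono (interior_subset_range hh ha)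
    · apply measure_mono
      rintro _ ⟨x, rfl⟩
      exact grd_mem hh hK hc ha x
  have hcont : Continuous fun x => (hess φ x).det := by
    simp only [← det_dgrd]
    exact ContinuousLinearMap.continuous_det.comp (continuous_dgrd ha.cd)
  have hnn : 0 ≤ᵐ[volume] fun x => (hess φ x).det :=
    Filter.Eventually.of_forall fun x => hess_det_nonneg ha.cd ha.cv x
  refine ⟨⟨hcont.aestronglyMeasurable, ?_⟩, ?_⟩
  · rw [hasFiniteIntegral_iff_ofReal hnn, ← h1]
    exact hK.measure_lt_top
  · rw [integral_eq_lintegral_of_nonneg_ae hnn hcont.aestronglyMeasurable, h1]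

lemma supp_sum {m : ℕ} {K : Fin m → Set 𝔼} {h : Fin m → 𝔼 → ℝ} (hh : ∀ i, IsSupp (K i) (h i))
    {lam : Fin m → ℝ} (hl : ∀ i, 0 ≤ lam i) :
    IsSupp (∑ i, lam i • K i) (fun x => ∑ i, lam i * h i x) := by
  constructor
  · intro x y hy
    obtain ⟨g, hg, rfl⟩ := (Set.mem_fintype_sum _ _).1 hy
    rw [sum_inner]
    refine Finset.sum_le_sum fun i _ => ?_
    obtain ⟨z, hz, e⟩ := hg i
    rw [← e]
    simp only [real_inner_smul_left]
    exact mul_le_mul_of_nonneg_left ((hh i).1 x z hz) (hl i)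
  · intro x
    choose y hy e using fun i => (hh i).2 x
    refine ⟨∑ i, lam i • y i, (Set.mem_fintype_sum _ _).2
      ⟨fun i => lam i • y i, fun i => Set.smul_mem_smul_set (hy i), rfl⟩, ?_⟩
    rw [sum_inner]
    exact Finset.sum_congr rfl fun i _ => by rw [real_inner_smul_left, e]

lemma apx_sum {m : ℕ} {h φ : Fin m → 𝔼 → ℝ} (hh : ∀ i, IsApx (h i) (φ i))
    {lam : Fin m → ℝ} (hl : ∀ i, 0 ≤ lam i) :
    IsApx (fun x => ∑ i, lam i * h i x) (fun x => ∑ i, lam i * φ i x) := by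
  refine ⟨?_, ?_, ?_, ?_⟩
  · exact ContDiff.sum fun i _ => contDiff_const.mul (hh i).cd
  · refine ⟨convex_univ, fun x _ y _ a b ha hb hab => ?_⟩
    simp only [smul_eq_mul, Finset.mul_sum, ← Finset.sum_add_distrib]
    refine Finset.sum_le_sum fun i _ => ?_
    have := mul_le_mul_of_nonneg_left
      ((hh i).cv.2 (Set.mem_univ x) (Set.mem_univ y) ha hb hab) (hl i)
    simp only [smul_eq_mul] at this
    linarith
  · intro x v
    simp only [← Finset.sum_add_distrib]
    refine Finset.sum_le_sum fun i _ => ?_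
    have := mul_le_mul_of_nonneg_left ((hh i).up x v) (hl i)
    linarith
  · choose C hC using fun i => (hh i).lo
    refine ⟨∑ i, lam i * C i, fun x => ?_⟩
    simp only [← Finset.sum_add_distrib]
    refine Finset.sum_le_sum fun i _ => ?_
    have := mul_le_mul_of_nonneg_left (hC i x) (hl i)
    linarith

lemma hess_sum {m : ℕ} {φ : Fin m → 𝔼 → ℝ} (hh : ∀ i, ContDiff ℝ 2 (φ i))
    (lam : Fin m → ℝ) (x : 𝔼) :
    hess (fun x => ∑ i, lam i * φ i x) x = ∑ i, lam i • hess (φ i) x := by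
  have h1 : fderiv ℝ (fun x => ∑ i, lam i * φ i x) = fun x => ∑ i, lam i • fderiv ℝ (φ i) x := by
    ext1 x
    exact (HasFDerivAt.fun_sum fun i _ => ((diff1 (hh i) x).hasFDerivAt.const_mul (lam i))).fderiv
  have h2 : fderiv ℝ (fun x => ∑ i, lam i • fderiv ℝ (φ i) x) x
      = ∑ i, lam i • fderiv ℝ (fderiv ℝ (φ i)) x :=
    (HasFDerivAt.fun_sum fun i _ => (((cd_fderiv (hh i)).differentiable
      (by norm_num) x).hasFDerivAt.const_smul (lam i))).fderiv
  ext j k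
  simp [hess, h1, h2, Matrix.sum_apply]

lemma cpt_sum {m : ℕ} {K : Fin m → Set 𝔼} (hK : ∀ i, IsCompact (K i)) (hc : ∀ i, Convex ℝ (K i))
    (lam : Fin m → ℝ) (s : Finset (Fin m)) :
    IsCompact (∑ i ∈ s, lam i • K i) ∧ Convex ℝ (∑ i ∈ s, lam i • K i) := by
  induction s using Finset.induction_on with
  | empty => exact ⟨by simp, by rw [Finset.sum_empty]; exact convex_singleton (𝕜 := ℝ) (0 : 𝔼)⟩
  | insert a s has ih =>
    rw [Finset.sum_insert has]
    exact ⟨((hK a).smul _).add ih.1, ((hc a).smul _).add ih.2⟩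

end

/-- **Minkowski's theorem on mixed volumes.** -/
theorem volume_of_minkowski_combination_is_homogeneous_polynomial
    (n m : ℕ) (K : Fin m → Set (EuclideanSpace ℝ (Fin n)))
    (hK_ne : ∀ i, (K i).Nonempty)
    (hK_cpt : ∀ i, IsCompact (K i))
    (hK_cvx : ∀ i, Convex ℝ (K i)) :
    ∃ P : MvPolynomial (Fin m) ℝ, P.IsHomogeneous n ∧
      ∀ lam : Fin m → ℝ, (∀ i, 0 ≤ lam i) →
        (volume (∑ i : Fin m, lam i • K i)).toReal = MvPolynomial.eval lam P := by
  choose h hh using fun i => exists_supp (hK_ne i) (hK_cpt i)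
  choose φ hφ using fun i => exists_apx (hh i) (hK_cpt i)
  choose q hq hqe using fun x => det_poly (fun i => hess (φ i) x)
  have key : ∀ lam : Fin m → ℝ, (∀ i, 0 ≤ lam i) →
      Integrable (fun x => MvPolynomial.eval lam (q x)) ∧
      (volume (∑ i : Fin m, lam i • K i)).toReal = ∫ x, MvPolynomial.eval lam (q x) := by
    intro lam hl
    have hc := cpt_sum hK_cpt hK_cvx lam Finset.univ
    have := volume_eq (supp_sum hh hl) hc.1 hc.2 (apx_sum hφ hl)
    simpa only [hqe, hess_sum (fun i => (hφ i).cd)] using this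
  obtain ⟨P, hP, hPe⟩ := poly_integral volume n m q hq (fun lam hl => (key lam hl).1)
  exact ⟨P, hP, fun lam hl => by rw [(key lam hl).2, hPe lam hl]⟩
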